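/- Let d and q satisfy d ≡ 3 (mod 4) and q ≡ 3 (mod 4), with d ≥ 3, and let A ⊆ F_q^d. Then (as inequalities of real numbers): if |A| ≥ (q^{(d+1)/2} + q)/(1 + q^{−(d−1)/2}), then SQ(A) ≤ |A|²/2 + q^{(d−1)/2}·|A| − |A|²/(2q) − |A|²/(2q^{(d−1)/2}) − |A|²/(2q^{(d+1)/2}); and if |A| ≤ (q^{(d+1)/2} + q)/(1 + q^{−(d−1)/2}), then SQ(A) ≤ |A|²/2 + q^{(d−1)/2}·|A|/2 − |A|²/(2q^{(d−1)/2}) − |A|/2. -/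

import Mathlib

open Finset

/-- `‖x‖ = x₁² + ⋯ + x_d²` for `x ∈ F_q^d`. -/
def normSq {d : ℕ} {F : Type} [Field F] [Fintype F] (x : Fin d → F) : F := ∑ i, x i ^ 2

/-- `SQ(A)` : the number of pairs `(x,y) ∈ A×A` with `η(‖x−y‖) = 1`,
where `η` is the quadratic character of `F` (with `η(0) = 0`). -/
noncomputable def SQpairs {d : ℕ} {F : Type} [Field F] [Fintype F] [DecidableEq F]
    (A : Finset (Fin d → F)) : ℕ :=
  ((A ×ˢ A).filter (fun p => quadraticChar F (normSq (p.1 - p.2)) = 1)).card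

/-- The quadratic character of a finite field with values in `ℂ`. -/
noncomputable def complexQuadraticChar (F : Type) [Field F] [Fintype F] [DecidableEq F] :
    MulChar F ℂ :=
  (quadraticChar F).ringHomComp (Int.castRingHom ℂ)

theorem ringChar_ne_two_of_card_mod_four {F : Type} [Field F] [Fintype F]
    (hq : Fintype.card F % 4 = 3) : ringChar F ≠ 2 := by
  intro h
  have := FiniteField.even_card_iff_char_two.mp h
  omega

theorem sum_prod_eq_prod_sum {F : Type} [Fintype F] {d : ℕ} (f : Fin d → F → ℂ) :
    ∑ ξ : Fin d → F, ∏ i, f i (ξ i) = ∏ i, ∑ a, f i a :=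
  (Fintype.prod_sum f).symm

theorem addChar_sum_eq_prod {F : Type} [Field F] {d : ℕ} (ψ : AddChar F ℂ) (f : Fin d → F) :
    ψ (∑ i, f i) = ∏ i, ψ (f i) :=
  map_prod ψ.toMonoidHom (fun i => Multiplicative.ofAdd (f i)) univ

/-- The squared modulus of the Fourier transform of the indicator function of `A`. -/
noncomputable def fourierEnergy {F : Type} [Field F] {d : ℕ} (ψ : AddChar F ℂ)
    (A : Finset (Fin d → F)) (ξ : Fin d → F) : ℝ :=
  Complex.normSq (∑ x ∈ A, ψ (ξ ⬝ᵥ x))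

theorem fourierEnergy_nonneg {F : Type} [Field F] {d : ℕ} (ψ : AddChar F ℂ)
    (A : Finset (Fin d → F)) (ξ : Fin d → F) :
    0 ≤ fourierEnergy ψ A ξ :=
  Complex.normSq_nonneg _

theorem fourierEnergy_zero {F : Type} [Field F] {d : ℕ} (ψ : AddChar F ℂ) (A : Finset (Fin d → F)) :
    fourierEnergy ψ A 0 = (A.card : ℝ) ^ 2 := by
  simp [fourierEnergy, Complex.normSq_natCast, pow_two]

theorem fourierEnergy_eq_sum {F : Type} [Field F] [Fintype F] {d : ℕ} (ψ : AddChar F ℂ)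
    (A : Finset (Fin d → F)) (ξ : Fin d → F) :
    (fourierEnergy ψ A ξ : ℂ) = ∑ p ∈ A ×ˢ A, ψ (ξ ⬝ᵥ (p.1 - p.2)) := by
  rw [fourierEnergy, ← Complex.mul_conj, map_sum, Finset.sum_mul_sum, ← Finset.sum_product']
  refine Finset.sum_congr rfl fun p _ => ?_
  rw [← AddChar.map_neg_eq_conj, ← AddChar.map_add_eq_mul, dotProduct_sub, sub_eq_add_neg]

theorem sum_mul_fourierEnergy {F : Type} [Field F] [Fintype F] {d : ℕ} (ψ : AddChar F ℂ)
    (A : Finset (Fin d → F)) (h : (Fin d → F) → ℂ) :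
    ∑ ξ, h ξ * (fourierEnergy ψ A ξ : ℂ) =
      ∑ p ∈ A ×ˢ A, ∑ ξ, h ξ * ψ (ξ ⬝ᵥ (p.1 - p.2)) := by
  rw [Finset.sum_comm]
  refine Finset.sum_congr rfl fun ξ _ => ?_
  rw [fourierEnergy_eq_sum, Finset.mul_sum]

theorem sum_product_ite_sub_eq_zero {F : Type} [Field F] [DecidableEq F] {d : ℕ}
    (A : Finset (Fin d → F)) (c : ℂ) :
    ∑ p ∈ A ×ˢ A, (if p.1 - p.2 = 0 then c else 0) = A.card * c := by
  rw [Finset.sum_product]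
  simp [sub_eq_zero]

section FourierAnalysis

variable {F : Type} [Field F] [Fintype F] [DecidableEq F] {d : ℕ}

theorem complexQuadraticChar_apply (a : F) :
    complexQuadraticChar F a = ((quadraticChar F a : ℤ) : ℂ) := rfl

theorem complexQuadraticChar_sq {a : F} (ha : a ≠ 0) : complexQuadraticChar F a ^ 2 = 1 := by
  rw [complexQuadraticChar_apply]
  exact_mod_cast quadraticChar_sq_one ha

theorem complexQuadraticChar_inv (a : F) :
    complexQuadraticChar F a⁻¹ = complexQuadraticChar F a := by
  by_cases ha : a = 0
  · simp [ha, MulChar.map_zero]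
  · have h1 : complexQuadraticChar F a⁻¹ * complexQuadraticChar F a = 1 := by
      rw [← map_mul, inv_mul_cancel₀ ha, map_one]
    have h2 := complexQuadraticChar_sq ha
    linear_combination complexQuadraticChar F a * h1 - complexQuadraticChar F a⁻¹ * h2

theorem complexQuadraticChar_ne_one (hF : ringChar F ≠ 2) : complexQuadraticChar F ≠ 1 := by
  obtain ⟨a, ha⟩ := quadraticChar_exists_neg_one' hF
  intro h
  have h2 : complexQuadraticChar F a = 1 := by rw [h, MulChar.one_apply a.isUnit]
  rw [complexQuadraticChar_apply, ha] at h2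
  norm_num at h2

theorem complexQuadraticChar_isQuadratic : (complexQuadraticChar F).IsQuadratic :=
  MulChar.IsQuadratic.comp (quadraticChar_isQuadratic F) _

theorem complexQuadraticChar_neg_one (hq : Fintype.card F % 4 = 3) :
    complexQuadraticChar F (-1) = -1 := by
  rw [complexQuadraticChar_apply, quadraticChar_neg_one (ringChar_ne_two_of_card_mod_four hq),
    ZMod.χ₄_nat_three_mod_four hq]
  norm_num

theorem gaussSum_complexQuadraticChar_sq (hq : Fintype.card F % 4 = 3) {ψ : AddChar F ℂ}
    (hψ : ψ.IsPrimitive) :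
    gaussSum (complexQuadraticChar F) ψ ^ 2 = -(Fintype.card F : ℂ) := by
  rw [gaussSum_sq (complexQuadraticChar_ne_one (ringChar_ne_two_of_card_mod_four hq))
    complexQuadraticChar_isQuadratic hψ, complexQuadraticChar_neg_one hq]
  ring

theorem sum_complexQuadraticChar_mul_addChar (hF : ringChar F ≠ 2) (ψ : AddChar F ℂ) (s : F) :
    ∑ t, complexQuadraticChar F t * ψ (s * t) =
      complexQuadraticChar F s * gaussSum (complexQuadraticChar F) ψ := by
  by_cases hs : s = 0
  · simpa [hs, MulChar.map_zero] using MulChar.sum_eq_zero_of_ne_one (complexQuadraticChar_ne_one hF)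
  · have h := gaussSum_mulShift (complexQuadraticChar F) ψ (Units.mk0 s hs)
    have h2 := complexQuadraticChar_sq hs
    have h3 : ∑ t, complexQuadraticChar F t * ψ (s * t) =
        gaussSum (complexQuadraticChar F) (ψ.mulShift (Units.mk0 s hs : F)) := rfl
    rw [h3, ← h, Units.val_mk0]
    linear_combination -gaussSum (complexQuadraticChar F) (ψ.mulShift s) * h2

theorem sum_addChar_mul_sq (hF : ringChar F ≠ 2) {ψ : AddChar F ℂ} (hψ : ψ.IsPrimitive)
    {s : F} (hs : s ≠ 0) :
    ∑ a, ψ (s * a ^ 2) = complexQuadraticChar F s * gaussSum (complexQuadraticChar F) ψ := by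
  have h1 : ∑ a, ψ (s * a ^ 2) = ∑ t, (complexQuadraticChar F t + 1) * ψ (s * t) := by
    rw [← Finset.sum_fiberwise (s := univ) (g := fun a : F => a ^ 2)]
    refine Finset.sum_congr rfl fun t _ => ?_
    have h2 := quadraticChar_card_sqrts hF t
    rw [Finset.sum_congr rfl (g := fun _ => ψ (s * t))
      (fun a ha => by rw [(Finset.mem_filter.mp ha).2]), Finset.sum_const, nsmul_eq_mul]
    congr 1
    rw [complexQuadraticChar_apply]
    have h3 : ((#(univ.filter fun a : F => a ^ 2 = t) : ℕ) : ℤ) = quadraticChar F t + 1 := by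
      rw [← h2]
      congr 2
      ext a
      simp
    exact_mod_cast congrArg (Int.cast : ℤ → ℂ) h3
  have h4 : ∑ t, ψ (s * t) = 0 := by
    have := AddChar.sum_mulShift s hψ
    rw [if_neg hs] at this
    simpa [mul_comm] using this
  rw [h1]
  simp_rw [add_mul, one_mul, Finset.sum_add_distrib]
  rw [h4, add_zero, sum_complexQuadraticChar_mul_addChar hF]

theorem sum_addChar_quadratic (hF : ringChar F ≠ 2) {ψ : AddChar F ℂ} (hψ : ψ.IsPrimitive)
    {s : F} (hs : s ≠ 0) (b : F) :
    ∑ a, ψ (s * a ^ 2 + a * b) =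
      complexQuadraticChar F s * gaussSum (complexQuadraticChar F) ψ * ψ (-4⁻¹ * s⁻¹ * b ^ 2) := by
  have h2 : (2 : F) ≠ 0 := Ring.two_ne_zero hF
  have h4 : (4 : F) = 2 * 2 := by norm_num
  rw [← sum_addChar_mul_sq hF hψ hs, Finset.sum_mul,
    ← Equiv.sum_comp (Equiv.addRight (b / (2 * s))) (fun a => ψ (s * a ^ 2) * _)]
  refine Finset.sum_congr rfl fun a _ => ?_
  rw [← AddChar.map_add_eq_mul, Equiv.coe_addRight, h4]
  congr 1
  field_simp
  ring

theorem sum_addChar_dotProduct {ψ : AddChar F ℂ} (hψ : ψ.IsPrimitive) (w : Fin d → F) :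
    ∑ ξ : Fin d → F, ψ (ξ ⬝ᵥ w) = if w = 0 then (Fintype.card F : ℂ) ^ d else 0 := by
  simp_rw [dotProduct, addChar_sum_eq_prod]
  rw [sum_prod_eq_prod_sum fun i a => ψ (a * w i)]
  simp_rw [AddChar.sum_mulShift _ hψ]
  split_ifs with h
  · simp [h]
  · obtain ⟨i, hi⟩ := Function.ne_iff.mp h
    exact Finset.prod_eq_zero (Finset.mem_univ i) (by simpa using hi)

theorem sum_addChar_normSq_dotProduct (hF : ringChar F ≠ 2) {ψ : AddChar F ℂ}
    (hψ : ψ.IsPrimitive) {s : F} (hs : s ≠ 0) (w : Fin d → F) :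
    ∑ ξ : Fin d → F, ψ (s * normSq ξ + ξ ⬝ᵥ w) =
      (complexQuadraticChar F s * gaussSum (complexQuadraticChar F) ψ) ^ d *
        ψ (-4⁻¹ * s⁻¹ * normSq w) := by
  simp_rw [normSq, dotProduct, Finset.mul_sum, ← Finset.sum_add_distrib, addChar_sum_eq_prod]
  rw [sum_prod_eq_prod_sum fun i a => ψ (s * a ^ 2 + a * w i)]
  simp_rw [sum_addChar_quadratic hF hψ hs]
  rw [Finset.prod_mul_distrib, Finset.prod_const, Finset.card_univ, Fintype.card_fin]

theorem sum_addChar_isotropic {m : ℕ} (hm : Odd m) (hq : Fintype.card F % 4 = 3)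
    {ψ : AddChar F ℂ} (hψ : ψ.IsPrimitive) (w : Fin (2 * m + 1) → F) :
    ∑ ξ : Fin (2 * m + 1) → F, (if normSq ξ = 0 then ψ (ξ ⬝ᵥ w) else 0) =
      (if w = 0 then (Fintype.card F : ℂ) ^ (2 * m) else 0) -
        (Fintype.card F : ℂ) ^ m * complexQuadraticChar F (normSq w) := by
  have hF := ringChar_ne_two_of_card_mod_four hq
  have hq0 : (Fintype.card F : ℂ) ≠ 0 := by exact_mod_cast Fintype.card_ne_zero
  set η := complexQuadraticChar F with hη
  set G := gaussSum η ψ with hG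
  have hG2 : G ^ 2 = -(Fintype.card F : ℂ) := gaussSum_complexQuadraticChar_sq hq hψ
  have h1 : ∀ ξ : Fin (2 * m + 1) → F,
      (Fintype.card F : ℂ) * (if normSq ξ = 0 then ψ (ξ ⬝ᵥ w) else 0) =
        ∑ s, ψ (s * normSq ξ + ξ ⬝ᵥ w) := by
    intro ξ
    simp_rw [AddChar.map_add_eq_mul, ← Finset.sum_mul, AddChar.sum_mulShift _ hψ]
    split_ifs <;> simp
  have h4 : η (-4⁻¹) = -1 := by
    have h22 : (-4⁻¹ : F) = -1 * (2⁻¹ * 2⁻¹) := by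
      rw [← mul_inv]; norm_num
    have h2 : (2⁻¹ : F) ≠ 0 := inv_ne_zero (Ring.two_ne_zero hF)
    rw [h22, map_mul, map_mul, ← pow_two, complexQuadraticChar_sq h2,
      complexQuadraticChar_neg_one hq, mul_one]
  have h5 : ∑ s, (η s * G) ^ (2 * m + 1) * ψ (-4⁻¹ * s⁻¹ * normSq w) =
      -(Fintype.card F : ℂ) ^ (m + 1) * η (normSq w) := by
    have h6 : ∀ s, (η s * G) ^ (2 * m + 1) * ψ (-4⁻¹ * s⁻¹ * normSq w) =
        G ^ (2 * m + 1) * (η s⁻¹ * ψ (-4⁻¹ * normSq w * s⁻¹)) := by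
      intro s
      rw [hη, complexQuadraticChar_inv, ← hη]
      have h7 : η s ^ (2 * m + 1) = η s := by
        by_cases hs : s = 0
        · simp [hs, MulChar.map_zero]
        · rw [pow_succ, pow_mul, complexQuadraticChar_sq hs, one_pow, one_mul]
      rw [mul_pow, h7, mul_right_comm (-4⁻¹ : F)]
      ring
    simp_rw [h6, ← Finset.mul_sum]
    have h7 : ∑ s : F, η s⁻¹ * ψ (-4⁻¹ * normSq w * s⁻¹) =
        ∑ s, η s * ψ (-4⁻¹ * normSq w * s) :=
      Equiv.sum_comp (Equiv.inv F) fun t => η t * ψ (-4⁻¹ * normSq w * t)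
    rw [h7, sum_complexQuadraticChar_mul_addChar hF, ← hη, ← hG, map_mul, h4]
    have h8 : G ^ (2 * m + 1) * G = (Fintype.card F : ℂ) ^ (m + 1) := by
      rw [← pow_succ, show 2 * m + 1 + 1 = 2 * (m + 1) by ring, pow_mul, hG2,
        (hm.add_one).neg_pow]
    linear_combination -η (normSq w) * h8
  have h9 : ∑ s, ∑ ξ : Fin (2 * m + 1) → F, ψ (s * normSq ξ + ξ ⬝ᵥ w) =
      (if w = 0 then (Fintype.card F : ℂ) ^ (2 * m + 1) else 0) -
        (Fintype.card F : ℂ) ^ (m + 1) * η (normSq w) := by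
    have h10 : ∀ s, ∑ ξ : Fin (2 * m + 1) → F, ψ (s * normSq ξ + ξ ⬝ᵥ w) =
        (if s = 0 then (if w = 0 then (Fintype.card F : ℂ) ^ (2 * m + 1) else 0) else 0) +
          (η s * G) ^ (2 * m + 1) * ψ (-4⁻¹ * s⁻¹ * normSq w) := by
      intro s
      by_cases hs : s = 0
      · simp [hs, MulChar.map_zero, sum_addChar_dotProduct hψ]
      · rw [sum_addChar_normSq_dotProduct hF hψ hs, if_neg hs, zero_add]
    simp_rw [h10, Finset.sum_add_distrib]
    rw [h5, Finset.sum_ite_eq' univ (0 : F)]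
    simp only [Finset.mem_univ, if_true]
    ring
  apply mul_left_cancel₀ hq0
  rw [Finset.mul_sum]
  simp_rw [h1]
  rw [Finset.sum_comm, h9]
  split_ifs <;> ring

theorem sum_complexQuadraticChar_normSq_mul_addChar {m : ℕ} (hm : Odd m)
    (hq : Fintype.card F % 4 = 3) {ψ : AddChar F ℂ} (hψ : ψ.IsPrimitive)
    (w : Fin (2 * m + 1) → F) :
    ∑ ξ : Fin (2 * m + 1) → F, complexQuadraticChar F (normSq ξ) * ψ (ξ ⬝ᵥ w) =
      (Fintype.card F : ℂ) ^ m -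
        (if normSq w = 0 then (Fintype.card F : ℂ) ^ (m + 1) else 0) := by
  have hq0 : (Fintype.card F : ℂ) ≠ 0 := by exact_mod_cast Fintype.card_ne_zero
  have h1 : ∀ ξ : Fin (2 * m + 1) → F,
      (Fintype.card F : ℂ) ^ m * (complexQuadraticChar F (normSq ξ) * ψ (ξ ⬝ᵥ w)) =
        (if ξ = 0 then (Fintype.card F : ℂ) ^ (2 * m) else 0) -
          ∑ ζ : Fin (2 * m + 1) → F, if normSq ζ = 0 then ψ (ξ ⬝ᵥ (ζ + w)) else 0 := by
    intro ξ
    have h2 := sum_addChar_isotropic hm hq hψ ξ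
    have h3 : ∑ ζ : Fin (2 * m + 1) → F, (if normSq ζ = 0 then ψ (ξ ⬝ᵥ (ζ + w)) else 0) =
        (∑ ζ : Fin (2 * m + 1) → F, (if normSq ζ = 0 then ψ (ζ ⬝ᵥ ξ) else 0)) *
          ψ (ξ ⬝ᵥ w) := by
      rw [Finset.sum_mul]
      refine Finset.sum_congr rfl fun ζ _ => ?_
      rw [dotProduct_add, AddChar.map_add_eq_mul, dotProduct_comm ξ ζ]
      split_ifs <;> simp
    rw [h3, h2]
    by_cases h0 : ξ = 0
    · simp [h0, normSq, MulChar.map_zero]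
    · simp [h0]
      ring
  have hneg : normSq (-w) = normSq w := by simp [normSq]
  have h4 : ∀ ζ : Fin (2 * m + 1) → F,
      ∑ ξ : Fin (2 * m + 1) → F, (if normSq ζ = 0 then ψ (ξ ⬝ᵥ (ζ + w)) else 0) =
        if ζ = -w then (if normSq w = 0 then (Fintype.card F : ℂ) ^ (2 * m + 1) else 0)
          else 0 := by
    intro ζ
    by_cases hζ : ζ = -w
    · subst hζ
      rw [hneg]
      by_cases hw : normSq w = 0 <;> simp [hw]
    · have h5 : ζ + w ≠ 0 := fun h => hζ (eq_neg_of_add_eq_zero_left h)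
      by_cases hw : normSq ζ = 0
      · simp only [hw, hζ, if_true, if_false, sum_addChar_dotProduct hψ, h5]
      · simp [hw, hζ]
  apply mul_left_cancel₀ (pow_ne_zero m hq0)
  rw [Finset.mul_sum]
  simp_rw [h1]
  rw [Finset.sum_sub_distrib, Finset.sum_comm]
  simp_rw [h4]
  rw [Finset.sum_ite_eq' univ (-w), Finset.sum_ite_eq' univ (0 : Fin (2 * m + 1) → F)]
  simp only [Finset.mem_univ, if_true]
  split_ifs <;> ring

theorem sum_fourierEnergy {ψ : AddChar F ℂ} (hψ : ψ.IsPrimitive) (A : Finset (Fin d → F)) :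
    ∑ ξ, fourierEnergy ψ A ξ = (A.card : ℝ) * (Fintype.card F : ℝ) ^ d := by
  have h := sum_mul_fourierEnergy ψ A fun _ => 1
  simp_rw [one_mul, sum_addChar_dotProduct hψ] at h
  rw [sum_product_ite_sub_eq_zero] at h
  exact_mod_cast h

theorem sum_isotropic_fourierEnergy {m : ℕ} (hm : Odd m) (hq : Fintype.card F % 4 = 3)
    {ψ : AddChar F ℂ} (hψ : ψ.IsPrimitive) (A : Finset (Fin (2 * m + 1) → F)) :
    ∑ ξ, (if normSq ξ = 0 then fourierEnergy ψ A ξ else 0) =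
      (A.card : ℝ) * (Fintype.card F : ℝ) ^ (2 * m) -
        (Fintype.card F : ℝ) ^ m *
          ∑ p ∈ A ×ˢ A, ((quadraticChar F (normSq (p.1 - p.2)) : ℤ) : ℝ) := by
  have h := sum_mul_fourierEnergy ψ A fun ξ => if normSq ξ = 0 then 1 else 0
  simp_rw [ite_mul, one_mul, zero_mul, sum_addChar_isotropic hm hq hψ] at h
  rw [Finset.sum_sub_distrib, sum_product_ite_sub_eq_zero, ← Finset.mul_sum] at h
  simp_rw [complexQuadraticChar_apply] at h
  apply Complex.ofReal_injective
  push_cast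
  simpa only [apply_ite Complex.ofReal, Complex.ofReal_zero] using h

theorem sum_quadraticChar_normSq_mul_fourierEnergy {m : ℕ} (hm : Odd m)
    (hq : Fintype.card F % 4 = 3) {ψ : AddChar F ℂ} (hψ : ψ.IsPrimitive)
    (A : Finset (Fin (2 * m + 1) → F)) :
    ∑ ξ, ((quadraticChar F (normSq ξ) : ℤ) : ℝ) * fourierEnergy ψ A ξ =
      (A.card : ℝ) ^ 2 * (Fintype.card F : ℝ) ^ m -
        (#((A ×ˢ A).filter fun p => normSq (p.1 - p.2) = 0) : ℝ) *
          (Fintype.card F : ℝ) ^ (m + 1) := by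
  have h := sum_mul_fourierEnergy ψ A fun ξ => complexQuadraticChar F (normSq ξ)
  simp_rw [sum_complexQuadraticChar_normSq_mul_addChar hm hq hψ] at h
  rw [Finset.sum_sub_distrib, ← Finset.sum_filter, Finset.sum_const, Finset.sum_const,
    Finset.card_product] at h
  simp_rw [complexQuadraticChar_apply, nsmul_eq_mul] at h
  rw [pow_two]
  exact_mod_cast h

theorem two_mul_SQpairs (A : Finset (Fin d → F)) :
    2 * (SQpairs A : ℝ) = (A.card : ℝ) ^ 2 -
      (#((A ×ˢ A).filter fun p => normSq (p.1 - p.2) = 0) : ℝ) +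
        ∑ p ∈ A ×ˢ A, ((quadraticChar F (normSq (p.1 - p.2)) : ℤ) : ℝ) := by
  have h1 : (A.card : ℝ) ^ 2 = ∑ p ∈ A ×ˢ A, 1 := by
    simp [pow_two]
  rw [SQpairs, h1, Finset.card_filter, Finset.card_filter]
  push_cast
  rw [Finset.mul_sum, ← Finset.sum_sub_distrib, ← Finset.sum_add_distrib]
  refine Finset.sum_congr rfl fun p _ => ?_
  by_cases h : normSq (p.1 - p.2) = 0
  · simp [h]
  · rcases quadraticChar_dichotomy h with h' | h' <;> norm_num [h, h']

theorem card_le_card_isotropic_pairs (A : Finset (Fin d → F)) :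
    A.card ≤ #((A ×ˢ A).filter fun p => normSq (p.1 - p.2) = 0) := by
  refine Finset.card_le_card_of_injOn (fun x => (x, x)) ?_ ?_
  · intro x hx
    simpa [normSq] using hx
  · intro x _ y _ h
    exact congrArg Prod.fst h

theorem card_sq_le_sum_isotropic_fourierEnergy (ψ : AddChar F ℂ) (A : Finset (Fin d → F)) :
    (A.card : ℝ) ^ 2 ≤ ∑ ξ, (if normSq ξ = 0 then fourierEnergy ψ A ξ else 0) := by
  have h := Finset.single_le_sum
    (f := fun ξ : Fin d → F => if normSq ξ = 0 then fourierEnergy ψ A ξ else 0)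
    (fun ξ _ => by
      have := fourierEnergy_nonneg ψ A ξ
      split_ifs <;> simp [this])
    (Finset.mem_univ 0)
  simpa [normSq, fourierEnergy_zero] using h

theorem sum_quadraticChar_mul_fourierEnergy_le (ψ : AddChar F ℂ) (A : Finset (Fin d → F)) :
    ∑ ξ, ((quadraticChar F (normSq ξ) : ℤ) : ℝ) * fourierEnergy ψ A ξ ≤
      ∑ ξ, fourierEnergy ψ A ξ -
        ∑ ξ, (if normSq ξ = 0 then fourierEnergy ψ A ξ else 0) := by
  rw [← Finset.sum_sub_distrib]
  refine Finset.sum_le_sum fun ξ _ => ?_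
  have := fourierEnergy_nonneg ψ A ξ
  by_cases h : normSq ξ = 0
  · simp [h]
  · rcases quadraticChar_dichotomy h with h' | h' <;> simp [h, h']
    linarith

end FourierAnalysis

theorem square_distances_d3q3 (q d : ℕ) (F : Type) [Field F] [Fintype F] [DecidableEq F]
    (hcard : Fintype.card F = q) (hodd : Odd q)
    (hd : d % 4 = 3) (hq : q % 4 = 3) (hd3 : 3 ≤ d)
    (A : Finset (Fin d → F)) :
    (((q : ℝ) ^ ((d + 1) / 2) + q) / (1 + 1 / (q : ℝ) ^ ((d - 1) / 2)) ≤ (A.card : ℝ) →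
      (SQpairs A : ℝ) ≤ (A.card : ℝ) ^ 2 / 2 + (q : ℝ) ^ ((d - 1) / 2) * (A.card : ℝ) - (A.card : ℝ) ^ 2 / (2 * q)
        - (A.card : ℝ) ^ 2 / (2 * (q : ℝ) ^ ((d - 1) / 2)) - (A.card : ℝ) ^ 2 / (2 * (q : ℝ) ^ ((d + 1) / 2)))
    ∧ ((A.card : ℝ) ≤ ((q : ℝ) ^ ((d + 1) / 2) + q) / (1 + 1 / (q : ℝ) ^ ((d - 1) / 2)) →
      (SQpairs A : ℝ) ≤ (A.card : ℝ) ^ 2 / 2 + (q : ℝ) ^ ((d - 1) / 2) * (A.card : ℝ) / 2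
        - (A.card : ℝ) ^ 2 / (2 * (q : ℝ) ^ ((d - 1) / 2)) - (A.card : ℝ) / 2) := by
  subst hcard
  obtain ⟨m, rfl⟩ : ∃ m, d = 2 * m + 1 := ⟨d / 2, by omega⟩
  have hm : Odd m := Nat.odd_iff.mpr (by omega)
  have e1 : (2 * m + 1 + 1) / 2 = m + 1 := by omega
  have e2 : (2 * m + 1 - 1) / 2 = m := by omega
  rw [e1, e2]
  have hψ := AddChar.FiniteField.primitiveChar_to_Complex_isPrimitive F
  set ψ := AddChar.FiniteField.primitiveChar_to_Complex F
  have hS := sum_isotropic_fourierEnergy hm hq hψ A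
  have hN := sum_quadraticChar_normSq_mul_fourierEnergy hm hq hψ A
  have hT := sum_fourierEnergy hψ A
  have hB := card_sq_le_sum_isotropic_fourierEnergy ψ A
  have hU := sum_quadraticChar_mul_fourierEnergy_le ψ A
  have hSQ := two_mul_SQpairs A
  have hC : (A.card : ℝ) ≤ (#((A ×ˢ A).filter fun p => normSq (p.1 - p.2) = 0) : ℝ) :=
    mod_cast card_le_card_isotropic_pairs A
  have hq0 : (0 : ℝ) < Fintype.card F := by exact_mod_cast Fintype.card_pos
  generalize (∑ p ∈ A ×ˢ A, ((quadraticChar F (normSq (p.1 - p.2)) : ℤ) : ℝ)) = S at *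
  generalize (#((A ×ˢ A).filter fun p => normSq (p.1 - p.2) = 0) : ℝ) = N at *
  generalize (∑ ξ, (if normSq ξ = 0 then fourierEnergy ψ A ξ else 0)) = B at *
  generalize (∑ ξ, ((quadraticChar F (normSq ξ) : ℤ) : ℝ) * fourierEnergy ψ A ξ) = U at *
  generalize (∑ ξ, fourierEnergy ψ A ξ) = T at *
  rw [hT, hN] at hU
  clear hN hT hψ ψ
  generalize (SQpairs A : ℝ) = X at *
  generalize (A.card : ℝ) = a at *
  have hQ0 : (0 : ℝ) < (Fintype.card F : ℝ) ^ m := pow_pos hq0 m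
  rw [pow_succ (Fintype.card F : ℝ) (2 * m)] at hU
  have hQ2 : (Fintype.card F : ℝ) ^ (2 * m) = ((Fintype.card F : ℝ) ^ m) ^ 2 := by ring
  rw [hQ2] at hS hU
  clear hQ2
  simp only [pow_succ (Fintype.card F : ℝ) m] at *
  generalize (Fintype.card F : ℝ) ^ m = Q at *
  generalize (Fintype.card F : ℝ) = r at *
  have hX : X = (a ^ 2 - N + S) / 2 := by linarith
  refine ⟨fun _ => ?_, fun _ => ?_⟩
  · have key : S - N ≤ 2 * Q * a - a ^ 2 / r - a ^ 2 / Q - a ^ 2 / (Q * r) := by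
      have h1 : 2 * Q * a - a ^ 2 / r - a ^ 2 / Q - a ^ 2 / (Q * r) =
          (2 * Q ^ 2 * a * r - a ^ 2 * Q - a ^ 2 * r - a ^ 2) / (Q * r) := by
        field_simp
      rw [h1, le_div_iff₀ (mul_pos hQ0 hq0)]
      nlinarith [mul_le_mul_of_nonneg_left hB hq0.le]
    have h2 : a ^ 2 / 2 + Q * a - a ^ 2 / (2 * r) - a ^ 2 / (2 * Q) - a ^ 2 / (2 * (Q * r)) =
        (a ^ 2 + (2 * Q * a - a ^ 2 / r - a ^ 2 / Q - a ^ 2 / (Q * r))) / 2 := by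
      field_simp
      ring
    rw [h2, hX]
    linarith
  · have key : S ≤ Q * a - a ^ 2 / Q := by
      have h1 : Q * a - a ^ 2 / Q = (Q ^ 2 * a - a ^ 2) / Q := by field_simp
      rw [h1, le_div_iff₀ hQ0]
      linarith
    have h2 : a ^ 2 / (2 * Q) = a ^ 2 / Q / 2 := by field_simp
    rw [h2, hX]
    linarith
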